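/- arXiv:1804.01409 — 3 statements merged into one kernel-verified Lean document; each statement's English description precedes it below -/
import Mathlib

section
/- Let y, y' ∈ ℝ^d and let γ(τ) = τy' + (1−τ)y for τ ∈ [0,1]. Then |F(|y'|)y' − F(|y|)y| ≤ (1+α_N)·|y' − y|·∫₀¹ F(|γ(τ)|) dτ. -/
open Finset intervalIntegral

/-- If `γ` vanishes at `t`, the product `u • γ` only needs continuity of `u` at `t`
to be differentiable there. -/
theorem HasDerivAt.continuousAt_smul_of_eq_zero {E : Type*} [NormedAddCommGroup E]
    [NormedSpace ℝ E] {u : ℝ → ℝ} {γ : ℝ → E} {v : E} {t : ℝ}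
    (hγ : HasDerivAt γ v t) (hu : ContinuousAt u t) (h0 : γ t = 0) :
    HasDerivAt (fun x => u x • γ x) (u t • v) t := by
  rw [hasDerivAt_iff_tendsto_slope] at hγ ⊢
  refine ((hu.tendsto.mono_left nhdsWithin_le_nhds).smul hγ).congr fun x => ?_
  simp only [slope_def_module, h0, smul_zero, sub_zero]
  exact smul_comm _ _ _

theorem exists_hasDerivAt_norm_rpow_smul {E : Type*} [NormedAddCommGroup E]
    [InnerProductSpace ℝ E] {s : ℝ} (hs : 0 ≤ s) {γ : ℝ → E} {v : E} {t : ℝ}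
    (hγ : HasDerivAt γ v t) :
    ∃ w, HasDerivAt (fun x => ‖γ x‖ ^ s • γ x) w t ∧ ‖w‖ ≤ (1 + s) * ‖v‖ * ‖γ t‖ ^ s := by
  have hp : 0 ≤ ‖γ t‖ ^ s := by positivity
  by_cases h0 : γ t = 0
  · refine ⟨_, hγ.continuousAt_smul_of_eq_zero
      (hγ.continuousAt.norm.rpow_const (Or.inr hs)) h0, ?_⟩
    rw [norm_smul, Real.norm_of_nonneg hp]
    nlinarith [mul_nonneg hs (mul_nonneg hp (norm_nonneg v))]
  · have hpos : 0 < ‖γ t‖ := norm_pos_iff.mpr h0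
    have hsq (x : ℝ) : (‖γ x‖ ^ 2) ^ (s / 2) = ‖γ x‖ ^ s := by
      rw [← Real.rpow_natCast_mul (norm_nonneg _)]
      congr 1
      push_cast
      ring
    have h1 := hγ.norm_sq.rpow_const (p := s / 2) (Or.inl (by positivity))
    simp only [hsq] at h1
    refine ⟨_, h1.smul hγ, ?_⟩
    have h2 : (‖γ t‖ ^ 2) ^ (s / 2 - 1) * ‖γ t‖ ^ 2 = ‖γ t‖ ^ s := by
      rw [← hsq t, ← Real.rpow_add_one (by positivity)]
      congr 1
      ring
    have h3 : 0 ≤ (‖γ t‖ ^ 2) ^ (s / 2 - 1) := by positivity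
    have h4 := abs_real_inner_le_norm (γ t) v
    calc _ ≤ ‖γ t‖ ^ s * ‖v‖ + s * |inner ℝ (γ t) v| * (‖γ t‖ ^ 2) ^ (s / 2 - 1) * ‖γ t‖ := by
          refine (norm_add_le _ _).trans (le_of_eq ?_)
          rw [norm_smul, norm_smul, Real.norm_of_nonneg hp, Real.norm_eq_abs, abs_mul, abs_mul,
            abs_mul, abs_of_nonneg h3, abs_of_nonneg (by positivity : 0 ≤ s / 2), abs_two]
          ring
      _ ≤ ‖γ t‖ ^ s * ‖v‖ + s * (‖γ t‖ * ‖v‖) * (‖γ t‖ ^ 2) ^ (s / 2 - 1) * ‖γ t‖ := by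
          gcongr
      _ = _ := by
          rw [← h2]
          ring

theorem norm_rpow_smul_sub_le_integral {E : Type*} [NormedAddCommGroup E]
    [InnerProductSpace ℝ E] {s : ℝ} (hs : 0 ≤ s) (y y' : E) :
    ‖‖y'‖ ^ s • y' - ‖y‖ ^ s • y‖ ≤
      (1 + s) * ‖y' - y‖ * ∫ τ in (0:ℝ)..1, ‖τ • y' + (1 - τ) • y‖ ^ s := by
  set γ : ℝ → E := fun τ => τ • y' + (1 - τ) • y with hγ_def
  have hγ (t : ℝ) : HasDerivAt γ (y' - y) t := by
    have h := ((hasDerivAt_id t).smul_const y').add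
      (((hasDerivAt_id t).const_sub 1).smul_const y)
    simp only [one_smul, neg_smul, ← sub_eq_add_neg] at h
    exact h
  have hcont : Continuous fun τ => ‖γ τ‖ ^ s :=
    (continuous_iff_continuousAt.mpr fun t => (hγ t).continuousAt).norm.rpow_const
      fun _ => Or.inr hs
  choose w hw hwle using fun t => exists_hasDerivAt_norm_rpow_smul hs (hγ t)
  have key := image_norm_le_of_norm_deriv_right_le_deriv_boundary
    (f := fun t => ‖γ t‖ ^ s • γ t - ‖γ 0‖ ^ s • γ 0) (f' := w) (a := 0) (b := 1)
    (B := fun t => (1 + s) * ‖y' - y‖ * ∫ τ in (0:ℝ)..t, ‖γ τ‖ ^ s)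
    (B' := fun t => (1 + s) * ‖y' - y‖ * ‖γ t‖ ^ s)
    (fun t _ => ((hw t).sub_const _).continuousAt.continuousWithinAt)
    (fun t _ => ((hw t).sub_const _).hasDerivWithinAt) (by simp)
    (fun t => (hcont.integral_hasStrictDerivAt 0 t).hasDerivAt.const_mul _)
    (fun t _ => hwle t) (Set.right_mem_Icc.mpr zero_le_one)
  simpa [hγ_def] using key

/-- With `γ(τ) = τ y' + (1−τ) y`,
`|F(|y'|)y' − F(|y|)y| ≤ (1+α_N)·|y'−y|·∫₀¹ F(|γ(τ)|) dτ`. -/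
theorem forchheimer_difference_integral_bound
    (d N : ℕ) (hd : 1 ≤ d) (hN : 1 ≤ N)
    (α a : ℕ → ℝ) (hα0 : α 0 = 0) (hαmono : ∀ i < N, α i < α (i + 1))
    (ha : ∀ i ≤ N, 0 ≤ a i)
    (F : ℝ → ℝ) (hF : ∀ z, F z = ∑ i ∈ Finset.range (N + 1), a i * z ^ α i)
    (y y' : EuclideanSpace ℝ (Fin d)) :
    ‖F ‖y'‖ • y' - F ‖y‖ • y‖ ≤
      (1 + α N) * ‖y' - y‖ * ∫ τ in (0:ℝ)..1, F ‖τ • y' + (1 - τ) • y‖ := by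
  have hmono {i j : ℕ} (hij : i ≤ j) : j ≤ N → α i ≤ α j := by
    induction j, hij using Nat.le_induction with
    | base => exact fun _ => le_rfl
    | succ j _ ih => exact fun hj => (ih (by lia)).trans (hαmono j (by lia)).le
  have hnonneg {i : ℕ} (hi : i ≤ N) : 0 ≤ α i := hα0 ▸ hmono (Nat.zero_le i) hi
  have hcont {i : ℕ} (hi : i ≤ N) :
      Continuous fun τ : ℝ => ‖τ • y' + (1 - τ) • y‖ ^ α i :=
    Continuous.rpow_const (by fun_prop) fun _ => Or.inr (hnonneg hi)
  simp only [hF]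
  rw [intervalIntegral.integral_finsetSum fun i hi =>
      ((hcont (by simpa [Nat.lt_succ_iff] using hi)).const_mul (a i)).intervalIntegrable 0 1,
    Finset.sum_smul, Finset.sum_smul, ← Finset.sum_sub_distrib, Finset.mul_sum]
  refine norm_sum_le_of_le _ fun i hi => ?_
  have hi' : i ≤ N := by simpa [Nat.lt_succ_iff] using hi
  have hint : 0 ≤ ∫ τ in (0:ℝ)..1, ‖τ • y' + (1 - τ) • y‖ ^ α i :=
    intervalIntegral.integral_nonneg zero_le_one fun _ _ => by positivity
  rw [intervalIntegral.integral_const_mul, mul_smul, mul_smul, ← smul_sub, norm_smul,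
    Real.norm_of_nonneg (ha i hi'), mul_left_comm]
  refine mul_le_mul_of_nonneg_left ?_ (ha i hi')
  refine (norm_rpow_smul_sub_le_integral (hnonneg hi') y y').trans ?_
  gcongr
  exact hmono hi' le_rfl
end

section
/- For all y, y' ∈ ℝ^d: (F(|y'|)y' − F(|y|)y) · (y' − y) ≥ |y' − y|² · ( a₀ + (1+α₁)·a_N·|y' − y|^{α_N} / (2^{α_N+1}(α_N+1)) ). -/
open Finset RealInnerProductSpace

/-- Power-law monotonicity: the vector field `x ↦ ‖x‖ ^ p • x` satisfies
`‖y - x‖ ^ (p + 2) / 2 ^ (p + 1) ≤ ⟪‖y‖ ^ p • y - ‖x‖ ^ p • x, y - x⟫`. -/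
theorem norm_sq_mul_rpow_div_le_inner_rpow_norm_smul_sub {E : Type*} [NormedAddCommGroup E]
    [InnerProductSpace ℝ E] {p : ℝ} (hp : 0 ≤ p) (x y : E) :
    ‖y - x‖ ^ 2 * (‖y - x‖ ^ p / (2 : ℝ) ^ (p + 1)) ≤
      ⟪‖y‖ ^ p • y - ‖x‖ ^ p • x, y - x⟫ := by
  have hid : ⟪‖y‖ ^ p • y - ‖x‖ ^ p • x, y - x⟫ =
      1 / 2 * (‖y‖ ^ p + ‖x‖ ^ p) * ‖y - x‖ ^ 2 +
        1 / 2 * ((‖y‖ ^ p - ‖x‖ ^ p) * (‖y‖ ^ 2 - ‖x‖ ^ 2)) := by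
    rw [norm_sub_sq_real]
    simp only [inner_sub_left, inner_sub_right, real_inner_smul_left, real_inner_self_eq_norm_sq,
      real_inner_comm y x]
    ring
  have hmono : 0 ≤ (‖y‖ ^ p - ‖x‖ ^ p) * (‖y‖ ^ 2 - ‖x‖ ^ 2) := by
    rcases le_total ‖x‖ ‖y‖ with h | h
    · exact mul_nonneg (sub_nonneg.2 (by gcongr)) (sub_nonneg.2 (by gcongr))
    · exact mul_nonneg_of_nonpos_of_nonpos (sub_nonpos.2 (by gcongr)) (sub_nonpos.2 (by gcongr))
  have hhalf : (‖y - x‖ / 2) ^ p ≤ ‖y‖ ^ p + ‖x‖ ^ p := by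
    have htri := norm_sub_le y x
    rcases le_total ‖x‖ ‖y‖ with h | h
    · have : (‖y - x‖ / 2) ^ p ≤ ‖y‖ ^ p :=
        Real.rpow_le_rpow (by positivity) (by linarith) hp
      linarith [Real.rpow_nonneg (norm_nonneg x) p]
    · have : (‖y - x‖ / 2) ^ p ≤ ‖x‖ ^ p :=
        Real.rpow_le_rpow (by positivity) (by linarith) hp
      linarith [Real.rpow_nonneg (norm_nonneg y) p]
  have hscale : ‖y - x‖ ^ p / (2 : ℝ) ^ (p + 1) = 1 / 2 * (‖y - x‖ / 2) ^ p := by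
    rw [Real.div_rpow (norm_nonneg _) zero_le_two, Real.rpow_add_one two_ne_zero]
    field_simp
  rw [hid, hscale]
  nlinarith [mul_le_mul_of_nonneg_right hhalf (sq_nonneg ‖y - x‖)]

/-- Quantitative monotonicity with explicit constants:
`(F(|y'|)y' − F(|y|)y)·(y'−y) ≥ |y'−y|²·(a₀ + (1+α₁)a_N|y'−y|^{α_N}/(2^{α_N+1}(α_N+1)))`. -/
theorem forchheimer_monotonicity_explicit
    (d N : ℕ) (hd : 1 ≤ d) (hN : 1 ≤ N)
    (α a : ℕ → ℝ) (hα0 : α 0 = 0) (hαmono : ∀ i < N, α i < α (i + 1))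
    (ha : ∀ i ≤ N, 0 ≤ a i)
    (F : ℝ → ℝ) (hF : ∀ z, F z = ∑ i ∈ Finset.range (N + 1), a i * z ^ α i)
    (y y' : EuclideanSpace ℝ (Fin d)) :
    ‖y' - y‖ ^ 2 *
        (a 0 + (1 + α 1) * a N * ‖y' - y‖ ^ α N / ((2 : ℝ) ^ (α N + 1) * (α N + 1))) ≤
      ⟪F ‖y'‖ • y' - F ‖y‖ • y, y' - y⟫ := by
  have hmono : ∀ i j, i ≤ j → j ≤ N → α i ≤ α j := by
    intro i j hij
    induction j, hij using Nat.le_induction with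
    | base => exact fun _ => le_rfl
    | succ k _ ih => exact fun hk => (ih (by omega)).trans (hαmono k (by omega)).le
  have hnonneg : ∀ i ≤ N, 0 ≤ α i := fun i hi => hα0 ▸ hmono 0 i (Nat.zero_le i) hi
  have hsum : ⟪F ‖y'‖ • y' - F ‖y‖ • y, y' - y⟫ = ∑ i ∈ Finset.range (N + 1),
      a i * ⟪‖y'‖ ^ α i • y' - ‖y‖ ^ α i • y, y' - y⟫ := by
    simp only [hF, inner_sub_left, real_inner_smul_left, Finset.sum_mul,
      ← Finset.sum_sub_distrib, mul_sub, mul_assoc]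
  have hterm : ∀ i ∈ Finset.range (N + 1),
      0 ≤ a i * ⟪‖y'‖ ^ α i • y' - ‖y‖ ^ α i • y, y' - y⟫ := by
    intro i hi
    have hi : i ≤ N := Nat.lt_succ_iff.1 (Finset.mem_range.1 hi)
    exact mul_nonneg (ha i hi) (le_trans (by positivity)
      (norm_sq_mul_rpow_div_le_inner_rpow_norm_smul_sub (hnonneg i hi) y y'))
  have hpair : a 0 * ⟪‖y'‖ ^ α 0 • y' - ‖y‖ ^ α 0 • y, y' - y⟫ +
      a N * ⟪‖y'‖ ^ α N • y' - ‖y‖ ^ α N • y, y' - y⟫ ≤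
        ⟪F ‖y'‖ • y' - F ‖y‖ • y, y' - y⟫ := by
    rw [hsum]
    exact Finset.add_le_sum hterm (by simp) (by simp) (by omega)
  have hzero : ⟪‖y'‖ ^ α 0 • y' - ‖y‖ ^ α 0 • y, y' - y⟫ = ‖y' - y‖ ^ 2 := by
    rw [hα0, Real.rpow_zero, Real.rpow_zero, one_smul, one_smul, real_inner_self_eq_norm_sq]
  have hNpos : 0 < α N + 1 := by linarith [hnonneg N le_rfl]
  have hratio : (1 + α 1) / (α N + 1) ≤ 1 := by
    rw [div_le_one hNpos]
    linarith [hmono 1 N hN le_rfl]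
  have htop : a N * (‖y' - y‖ ^ 2 * (‖y' - y‖ ^ α N / (2 : ℝ) ^ (α N + 1))) ≤
      a N * ⟪‖y'‖ ^ α N • y' - ‖y‖ ^ α N • y, y' - y⟫ :=
    mul_le_mul_of_nonneg_left
      (norm_sq_mul_rpow_div_le_inner_rpow_norm_smul_sub (hnonneg N le_rfl) y y') (ha N le_rfl)
  have hT : 0 ≤ a N * (‖y' - y‖ ^ 2 * (‖y' - y‖ ^ α N / (2 : ℝ) ^ (α N + 1))) :=
    mul_nonneg (ha N le_rfl) (by positivity)
  calc
    _ = a 0 * ‖y' - y‖ ^ 2 + (1 + α 1) / (α N + 1) *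
        (a N * (‖y' - y‖ ^ 2 * (‖y' - y‖ ^ α N / (2 : ℝ) ^ (α N + 1)))) := by
      field_simp
    _ ≤ a 0 * ‖y' - y‖ ^ 2 +
        a N * (‖y' - y‖ ^ 2 * (‖y' - y‖ ^ α N / (2 : ℝ) ^ (α N + 1))) := by
      linarith [mul_le_of_le_one_left hT hratio]
    _ ≤ _ := by
      rw [hzero] at hpair
      linarith
end

section
/- Let α > 0 be a real number and y, y' ∈ ℝ^d. Then ∫₀¹ |τ y' + (1−τ) y|^{α} dτ ≥ |y' − y|^{α} / (2^{α+1}(α+1)). -/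
lemma norm_rpow_div_le_integral_segment_of_norm_le {E : Type*} [NormedAddCommGroup E]
    [NormedSpace ℝ E] {α : ℝ} (hα : 0 < α) {y y' : E} (h : ‖y‖ ≤ ‖y'‖) :
    ‖y' - y‖ ^ α / ((2 : ℝ) ^ (α + 1) * (α + 1)) ≤
      ∫ τ in (0:ℝ)..1, ‖τ • y' + (1 - τ) • y‖ ^ α := by
  have hcont : Continuous fun τ : ℝ => ‖τ • y' + (1 - τ) • y‖ ^ α :=
    Continuous.rpow_const (by fun_prop) fun _ => Or.inr hα.le
  have hcont' : Continuous fun τ : ℝ => ‖y' - y‖ ^ α * (τ - 1 / 2) ^ α :=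
    continuous_const.mul (Continuous.rpow_const (by fun_prop) fun _ => Or.inr hα.le)
  have hbound : ∀ τ ∈ Set.Icc (1 / 2 : ℝ) 1,
      ‖y' - y‖ ^ α * (τ - 1 / 2) ^ α ≤ ‖τ • y' + (1 - τ) • y‖ ^ α := by
    rintro τ ⟨h1, h2⟩
    rw [← Real.mul_rpow (norm_nonneg _) (by linarith)]
    refine Real.rpow_le_rpow (mul_nonneg (norm_nonneg _) (by linarith)) ?_ hα.le
    have htri : ‖τ • y'‖ - ‖(1 - τ) • y‖ ≤ ‖τ • y' + (1 - τ) • y‖ := by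
      simpa using norm_sub_norm_le (τ • y') (-((1 - τ) • y))
    rw [norm_smul, norm_smul, Real.norm_of_nonneg (by linarith : 0 ≤ τ),
      Real.norm_of_nonneg (by linarith : 0 ≤ 1 - τ)] at htri
    have hsub := norm_sub_le y' y
    nlinarith
  calc ‖y' - y‖ ^ α / ((2 : ℝ) ^ (α + 1) * (α + 1))
      = ∫ τ in (1 / 2 : ℝ)..1, ‖y' - y‖ ^ α * (τ - 1 / 2) ^ α := by
        rw [intervalIntegral.integral_const_mul,
          intervalIntegral.integral_comp_sub_right (fun x : ℝ => x ^ α),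
          integral_rpow (Or.inl (by linarith)), sub_self, Real.zero_rpow (by linarith),
          show (1 : ℝ) - 1 / 2 = 2⁻¹ by norm_num, Real.inv_rpow (by norm_num)]
        field_simp
        simp
    _ ≤ ∫ τ in (1 / 2 : ℝ)..1, ‖τ • y' + (1 - τ) • y‖ ^ α :=
        intervalIntegral.integral_mono_on (by norm_num) (hcont'.intervalIntegrable _ _)
          (hcont.intervalIntegrable _ _) hbound
    _ ≤ ∫ τ in (0:ℝ)..1, ‖τ • y' + (1 - τ) • y‖ ^ α :=
        intervalIntegral.integral_mono_interval (by norm_num) (by norm_num) le_rfl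
          (Filter.Eventually.of_forall fun _ => by positivity)
          (hcont.intervalIntegrable _ _)

/-- For `α > 0` and `y, y' ∈ ℝ^d`,
`∫₀¹ |τy' + (1−τ)y|^α dτ ≥ |y'−y|^α / (2^{α+1}(α+1))`. -/
theorem integral_segment_norm_rpow_lower_bound
    (d : ℕ) (hd : 1 ≤ d) (α : ℝ) (hα : 0 < α)
    (y y' : EuclideanSpace ℝ (Fin d)) :
    ‖y' - y‖ ^ α / ((2 : ℝ) ^ (α + 1) * (α + 1)) ≤
      ∫ τ in (0:ℝ)..1, ‖τ • y' + (1 - τ) • y‖ ^ α := by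
  rcases le_total ‖y‖ ‖y'‖ with h | h
  · exact norm_rpow_div_le_integral_segment_of_norm_le hα h
  · have hswap := intervalIntegral.integral_comp_sub_left (a := 0) (b := 1)
      (fun τ : ℝ => ‖τ • y' + (1 - τ) • y‖ ^ α) 1
    simp only [sub_sub_cancel, sub_self, sub_zero] at hswap
    rw [← hswap, norm_sub_rev]
    simpa only [add_comm] using norm_rpow_div_le_integral_segment_of_norm_le hα h
end
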